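/- For all x ∈ A: ⟨ω, ξ^{1/2} J(Ω_{(1)}) ξ^{1/2} x⟩ Ω_{(2)} = x; equivalently, ⟨ω, Ω_{(1)}⟩ Ω_{(2)} = ξ^{-1}. -/

import Mathlib

open scoped TensorProduct

noncomputable section

/-- An element of a `C*`-algebra is positive iff it is of the form `star y * y`. -/
def IsPosElem {A : Type*} [Mul A] [Star A] (x : A) : Prop := ∃ y : A, x = star y * y

section Helpers

variable {A : Type*} [NormedRing A] [StarRing A] [CStarRing A]
  [NormedAlgebra ℂ A] [StarModule ℂ A]

/-- Apply a linear functional to the first leg of a tensor (`⟨φ, u₁⟩ u₂`). -/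
def lapp (φ : A →ₗ[ℂ] ℂ) : A ⊗[ℂ] A →ₗ[ℂ] A :=
  (TensorProduct.lid ℂ A).toLinearMap ∘ₗ TensorProduct.map φ LinearMap.id

/-- Apply a linear functional to the second leg of a tensor (`⟨φ, u₂⟩ u₁`). -/
def rapp (φ : A →ₗ[ℂ] ℂ) : A ⊗[ℂ] A →ₗ[ℂ] A :=
  (TensorProduct.rid ℂ A).toLinearMap ∘ₗ TensorProduct.map LinearMap.id φ

/-- Apply a pair of linear functionals to the two legs of a tensor (`⟨φ, u₁⟩⟨ψ, u₂⟩`). -/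
def papp (φ ψ : A →ₗ[ℂ] ℂ) : A ⊗[ℂ] A →ₗ[ℂ] ℂ :=
  (TensorProduct.lid ℂ ℂ).toLinearMap ∘ₗ TensorProduct.map φ ψ

end Helpers

/-- A `C*`-weak Hopf algebra: a finite-dimensional unital `C*`-algebra `A` equipped with a
comultiplication `Δ` (written in Sweedler notation `Δ x = x₍₁₎ ⊗ x₍₂₎`), counit `ε` and
antipode `S`, satisfying the axioms of Böhm–Szlachányi.  The field `starT` is the
(componentwise) star operation on `A ⊗[ℂ] A`, characterized by additivity and its values on
pure tensors. -/
structure WeakHopfData (A : Type*) [NormedRing A] [StarRing A] [CStarRing A]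
    [NormedAlgebra ℂ A] [StarModule ℂ A] [FiniteDimensional ℂ A] : Type _ where
  Δ : A →ₗ[ℂ] A ⊗[ℂ] A
  ε : A →ₗ[ℂ] ℂ
  S : A ≃ₗ[ℂ] A
  starT : A ⊗[ℂ] A → A ⊗[ℂ] A
  starT_add : ∀ u v : A ⊗[ℂ] A, starT (u + v) = starT u + starT v
  starT_tmul : ∀ a b : A, starT (a ⊗ₜ[ℂ] b) = star a ⊗ₜ[ℂ] star b
  /-- coassociativity of the comultiplication -/
  coassoc : (TensorProduct.assoc ℂ A A A).toLinearMap ∘ₗ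
      (TensorProduct.map Δ LinearMap.id) ∘ₗ Δ = (TensorProduct.map LinearMap.id Δ) ∘ₗ Δ
  /-- counit axiom, left version -/
  counit_left : (TensorProduct.lid ℂ A).toLinearMap ∘ₗ (TensorProduct.map ε LinearMap.id) ∘ₗ Δ
      = LinearMap.id
  /-- counit axiom, right version -/
  counit_right : (TensorProduct.rid ℂ A).toLinearMap ∘ₗ (TensorProduct.map LinearMap.id ε) ∘ₗ Δ
      = LinearMap.id
  /-- the comultiplication is multiplicative -/
  Δ_mul : ∀ x y : A, Δ (x * y) = Δ x * Δ y
  /-- the star operation is comultiplicative -/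
  Δ_star : ∀ x : A, Δ (star x) = starT (Δ x)
  /-- the unit is weakly comultiplicative:
  `(Δ ⊗ id)(Δ 1) = (Δ 1 ⊗ 1)(1 ⊗ Δ 1)` -/
  Δ_one_weak : (TensorProduct.map Δ LinearMap.id) (Δ 1)
      = (Δ 1 ⊗ₜ[ℂ] (1 : A)) * ((TensorProduct.assoc ℂ A A A).symm ((1 : A) ⊗ₜ[ℂ] Δ 1))
  /-- the unit is weakly comultiplicative:
  `(Δ ⊗ id)(Δ 1) = (1 ⊗ Δ 1)(Δ 1 ⊗ 1)` -/
  Δ_one_weak' : (TensorProduct.map Δ LinearMap.id) (Δ 1)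
      = ((TensorProduct.assoc ℂ A A A).symm ((1 : A) ⊗ₜ[ℂ] Δ 1)) * (Δ 1 ⊗ₜ[ℂ] (1 : A))
  /-- the counit is weakly multiplicative: `ε (x y z) = ε (x y₍₁₎) ε (y₍₂₎ z)` -/
  ε_weak : ∀ x y z : A,
      ε (x * y * z) = papp (ε ∘ₗ LinearMap.mulLeft ℂ x) (ε ∘ₗ LinearMap.mulRight ℂ z) (Δ y)
  /-- the counit is weakly multiplicative: `ε (x y z) = ε (x y₍₂₎) ε (y₍₁₎ z)` -/
  ε_weak' : ∀ x y z : A,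
      ε (x * y * z) = papp (ε ∘ₗ LinearMap.mulRight ℂ z) (ε ∘ₗ LinearMap.mulLeft ℂ x) (Δ y)
  /-- antipode axiom: `x₍₁₎ S(x₍₂₎) = ε (1₍₁₎ x) 1₍₂₎` -/
  antipode_left : ∀ x : A,
      LinearMap.mul' ℂ A ((TensorProduct.map LinearMap.id S.toLinearMap) (Δ x))
        = lapp (ε ∘ₗ LinearMap.mulRight ℂ x) (Δ 1)
  /-- antipode axiom: `S(x₍₁₎) x₍₂₎ = 1₍₁₎ ε (x 1₍₂₎)` -/
  antipode_right : ∀ x : A,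
      LinearMap.mul' ℂ A ((TensorProduct.map S.toLinearMap LinearMap.id) (Δ x))
        = rapp (ε ∘ₗ LinearMap.mulLeft ℂ x) (Δ 1)
  /-- the antipode is antimultiplicative -/
  S_antimul : ∀ x y : A, S (x * y) = S y * S x
  /-- the antipode is anticomultiplicative -/
  S_anticomul : ∀ x : A,
      Δ (S x) = (TensorProduct.comm ℂ A A) ((TensorProduct.map S.toLinearMap S.toLinearMap) (Δ x))

namespace WeakHopfData

variable {A : Type*} [NormedRing A] [StarRing A] [CStarRing A]
  [NormedAlgebra ℂ A] [StarModule ℂ A] [FiniteDimensional ℂ A]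

/-- The source counital map `ε^L (x) = x₍₁₎ S(x₍₂₎)`. -/
def εL (W : WeakHopfData A) : A →ₗ[ℂ] A :=
  LinearMap.mul' ℂ A ∘ₗ TensorProduct.map LinearMap.id W.S.toLinearMap ∘ₗ W.Δ

/-- The target counital map `ε^R (x) = S(x₍₁₎) x₍₂₎`. -/
def εR (W : WeakHopfData A) : A →ₗ[ℂ] A :=
  LinearMap.mul' ℂ A ∘ₗ TensorProduct.map W.S.toLinearMap LinearMap.id ∘ₗ W.Δ

/-- Full contraction of the iterated coproduct `Δ⁽ⁿ⁾ x = x₍₁₎ ⊗ ⋯ ⊗ x₍ₙ₊₁₎` against a family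
of `n+1` linear functionals: `sweedlerEval W n φ x = ⟨φ 0, x₍₁₎⟩ ⋯ ⟨φ n, x₍ₙ₊₁₎⟩`.
Since linear functionals separate the points of a tensor power, identities between iterated
coproducts are faithfully expressed through these contractions. -/
def sweedlerEval (W : WeakHopfData A) : (n : ℕ) → (Fin (n + 1) → (A →ₗ[ℂ] ℂ)) → (A →ₗ[ℂ] ℂ)
  | 0, φ => φ 0
  | n + 1, φ => papp (sweedlerEval W n (Fin.init φ)) (φ (Fin.last (n + 1))) ∘ₗ W.Δ

end WeakHopfData

/-- A `C*`-weak Hopf algebra together with its canonical distinguished elements: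
the Haar integral `h`, the dual Haar integral `hHat`, the square roots `gL`, `gR` of
`E^L h`, `E^R h` (whence the canonical grouplike element `g = gL * gR⁻¹`), real powers
`gLpow`, `gRpow` of `gL` and `gR`, and a positive square root operation `sqrt`;
all characterized by the (uniquely determining) properties listed as fields. -/
structure HaarPkg (A : Type*) [NormedRing A] [StarRing A] [CStarRing A]
    [NormedAlgebra ℂ A] [StarModule ℂ A] [FiniteDimensional ℂ A] : Type _ where
  W : WeakHopfData A
  /-- the Haar integral -/
  h : A
  haar_left : ∀ x : A, x * h = WeakHopfData.εL W x * h
  haar_right : ∀ x : A, h * x = h * WeakHopfData.εR W x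
  haar_counitL : WeakHopfData.εL W h = 1
  haar_counitR : WeakHopfData.εR W h = 1
  haar_idem : h * h = h
  haar_star : star h = h
  haar_S : W.S h = h
  haar_nondeg : ∀ y : A, ∃ φ ψ : A →ₗ[ℂ] ℂ, lapp φ (W.Δ h) = y ∧ rapp ψ (W.Δ h) = y
  /-- the Haar integral of the dual weak Hopf algebra `A*`, as a linear functional on `A` -/
  hHat : A →ₗ[ℂ] ℂ
  hHat_pos : ∀ x : A, ∃ r : ℝ, 0 ≤ r ∧ hHat (star x * x) = (r : ℂ)
  hHat_S : ∀ x : A, hHat (W.S x) = hHat x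
  /-- `gL = (E^L h)^{1/2}` -/
  gL : A
  /-- `gR = (E^R h)^{1/2}` -/
  gR : A
  gL_pos : IsPosElem gL
  gR_pos : IsPosElem gR
  gL_unit : IsUnit gL
  gR_unit : IsUnit gR
  gL_sq : gL * gL = rapp hHat (W.Δ h)
  gR_sq : gR * gR = lapp hHat (W.Δ h)
  gL_mem : gL ∈ Set.range (WeakHopfData.εL W)
  gR_mem : gR ∈ Set.range (WeakHopfData.εR W)
  gR_S : gR = W.S gL
  gLR_comm : gL * gR = gR * gL
  /-- the canonical grouplike element `g = gL * gR⁻¹` is positive -/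
  g_pos : IsPosElem (gL * Ring.inverse gR)
  g_unit : IsUnit (gL * Ring.inverse gR)
  /-- `Δ g = (g ⊗ g) Δ 1` -/
  g_grouplike : W.Δ (gL * Ring.inverse gR)
      = ((gL * Ring.inverse gR) ⊗ₜ[ℂ] (gL * Ring.inverse gR)) * W.Δ 1
  /-- `Δ g = Δ 1 (g ⊗ g)` -/
  g_grouplike' : W.Δ (gL * Ring.inverse gR)
      = W.Δ 1 * ((gL * Ring.inverse gR) ⊗ₜ[ℂ] (gL * Ring.inverse gR))
  /-- `S g = g⁻¹` -/
  g_S : W.S (gL * Ring.inverse gR) = Ring.inverse (gL * Ring.inverse gR)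
  /-- `S² x = g x g⁻¹` -/
  S_sq : ∀ x : A,
      W.S (W.S x) = (gL * Ring.inverse gR) * x * Ring.inverse (gL * Ring.inverse gR)
  /-- `h₍₁₎ ⊗ g h₍₂₎ g = h₍₂₎ ⊗ h₍₁₎` -/
  haar_flip : TensorProduct.map LinearMap.id
      (LinearMap.mulLeft ℂ (gL * Ring.inverse gR) ∘ₗ LinearMap.mulRight ℂ (gL * Ring.inverse gR))
      (W.Δ h) = (TensorProduct.comm ℂ A A) (W.Δ h)
  /-- dual integral relation `⟨ĥ, x (h gL⁻²)⟩ = ε x` -/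
  hHat_dual₁ : ∀ x : A, hHat (x * (h * (Ring.inverse gL * Ring.inverse gL))) = W.ε x
  /-- dual integral relation `⟨ĥ, (gR⁻² h) x⟩ = ε x` -/
  hHat_dual₂ : ∀ x : A, hHat ((Ring.inverse gR * Ring.inverse gR * h) * x) = W.ε x
  /-- dual integral relation `⟨ĥ, (h gL⁻²)₍₂₎⟩ (h gL⁻²)₍₁₎ = 1` -/
  hHat_dual₃ : rapp hHat (W.Δ (h * (Ring.inverse gL * Ring.inverse gL))) = 1
  /-- dual integral relation `⟨ĥ, (gR⁻² h)₍₁₎⟩ (gR⁻² h)₍₂₎ = 1` -/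
  hHat_dual₄ : lapp hHat (W.Δ (Ring.inverse gR * Ring.inverse gR * h)) = 1
  /-- the positive square root, via the continuous functional calculus -/
  sqrt : A → A
  sqrt_pos : ∀ x : A, IsPosElem x → IsPosElem (sqrt x)
  sqrt_mul_self : ∀ x : A, IsPosElem x → sqrt x * sqrt x = x
  /-- real powers of `gL`, via the continuous functional calculus -/
  gLpow : ℝ → A
  /-- real powers of `gR`, via the continuous functional calculus -/
  gRpow : ℝ → A
  gLpow_one : gLpow 1 = gL
  gRpow_one : gRpow 1 = gR
  gLpow_zero : gLpow 0 = 1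
  gRpow_zero : gRpow 0 = 1
  gLpow_add : ∀ s t : ℝ, gLpow (s + t) = gLpow s * gLpow t
  gRpow_add : ∀ s t : ℝ, gRpow (s + t) = gRpow s * gRpow t
  gLpow_pos : ∀ t : ℝ, IsPosElem (gLpow t)
  gRpow_pos : ∀ t : ℝ, IsPosElem (gRpow t)
  gLpow_continuous : Continuous gLpow
  gRpow_continuous : Continuous gRpow

namespace HaarPkg

variable {A : Type*} [NormedRing A] [StarRing A] [CStarRing A]
  [NormedAlgebra ℂ A] [StarModule ℂ A] [FiniteDimensional ℂ A]
variable (P : HaarPkg A)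

/-- The canonical grouplike element `g = gL gR⁻¹`. -/
def g : A := P.gL * Ring.inverse P.gR

/-- The Watatani index `ı = ε^L (h gL⁻²)` of the Haar conditional expectations. -/
def iotaEl : A := WeakHopfData.εL P.W (P.h * (Ring.inverse P.gL * Ring.inverse P.gL))

/-- The element `ȷ = ⟨ĥ, (gL⁻²)₍₁₎⟩ (gL⁻²)₍₂₎`, the dual analogue of the Watatani index. -/
def jayEl : A := lapp P.hHat (P.W.Δ (Ring.inverse P.gL * Ring.inverse P.gL))

/-- The pulling-through element `Ω = ı⁻¹ gL⁻¹ h gL⁻¹`. -/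
def Ω : A := Ring.inverse P.iotaEl * Ring.inverse P.gL * P.h * Ring.inverse P.gL

/-- The map `J x = g^{-1/2} S(x) g^{1/2}`, as a linear map. -/
def Jlin : A →ₗ[ℂ] A :=
  LinearMap.mulRight ℂ (P.sqrt P.g) ∘ₗ
    LinearMap.mulLeft ℂ (Ring.inverse (P.sqrt P.g)) ∘ₗ P.W.S.toLinearMap

/-- The functional `⟨ω, x⟩ = ⟨ĥ, ȷ⁻¹ gL⁻¹ gR⁻¹ x⟩` (the dual analogue of `Ω`). -/
def ω : A →ₗ[ℂ] ℂ :=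
  P.hHat ∘ₗ LinearMap.mulLeft ℂ (Ring.inverse P.jayEl * (Ring.inverse P.gL * Ring.inverse P.gR))

/-- `ξ_L = ı^{1/2} ȷ^{1/2} gL`. -/
def ξL : A := P.sqrt P.iotaEl * P.sqrt P.jayEl * P.gL

/-- `ξ_R = ı^{1/2} ȷ^{1/2} gR`. -/
def ξR : A := P.sqrt P.iotaEl * P.sqrt P.jayEl * P.gR

/-- `ξ = ξ_L ξ_R`. -/
def ξ : A := P.ξL * P.ξR

/-- `J^L x = gL⁻¹ S(x) gL`. -/
def JL : A → A := fun x => Ring.inverse P.gL * P.W.S x * P.gL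

/-- `J^R x = gL S⁻¹(x) gL⁻¹`. -/
def JR : A → A := fun x => P.gL * P.W.S.symm x * Ring.inverse P.gL

end HaarPkg

section Contractions

variable {A : Type*} [NormedRing A] [StarRing A] [CStarRing A]
  [NormedAlgebra ℂ A] [StarModule ℂ A]

@[simp] lemma lapp_tmul (φ : A →ₗ[ℂ] ℂ) (a b : A) : lapp φ (a ⊗ₜ[ℂ] b) = φ a • b := by
  simp [lapp]

@[simp] lemma rapp_tmul (φ : A →ₗ[ℂ] ℂ) (a b : A) : rapp φ (a ⊗ₜ[ℂ] b) = φ b • a := by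
  simp [rapp]

@[simp] lemma papp_tmul (φ ψ : A →ₗ[ℂ] ℂ) (a b : A) : papp φ ψ (a ⊗ₜ[ℂ] b) = φ a * ψ b := by
  simp [papp]

lemma lapp_one_tmul_mul_mul (φ : A →ₗ[ℂ] ℂ) (u : A ⊗[ℂ] A) (b c : A) :
    lapp φ (((1 : A) ⊗ₜ[ℂ] b) * u * ((1 : A) ⊗ₜ[ℂ] c)) = b * lapp φ u * c := by
  induction u with
  | zero => simp
  | tmul x y => simp
  | add u v hu hv => simp only [mul_add, add_mul, map_add, hu, hv]

lemma lapp_tmul_one_mul_mul (φ : A →ₗ[ℂ] ℂ) (u : A ⊗[ℂ] A) (b c : A) :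
    lapp φ ((b ⊗ₜ[ℂ] (1 : A)) * u * (c ⊗ₜ[ℂ] (1 : A)))
      = lapp (φ ∘ₗ LinearMap.mulRight ℂ c ∘ₗ LinearMap.mulLeft ℂ b) u := by
  induction u with
  | zero => simp
  | tmul x y => simp
  | add u v hu hv => simp only [mul_add, add_mul, map_add, hu, hv]

lemma apply_lapp (φ ψ : A →ₗ[ℂ] ℂ) (u : A ⊗[ℂ] A) : ψ (lapp φ u) = φ (rapp ψ u) := by
  induction u with
  | zero => simp
  | tmul x y => simp [mul_comm]
  | add u v hu hv => simp only [map_add, hu, hv]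

lemma lapp_mul (φ : A →ₗ[ℂ] ℂ) (u : A ⊗[ℂ] A) (b : A) :
    lapp φ (u * ((1 : A) ⊗ₜ[ℂ] b)) = lapp φ u * b := by
  simpa [← Algebra.TensorProduct.one_def] using lapp_one_tmul_mul_mul φ u 1 b

lemma mul_lapp (φ : A →ₗ[ℂ] ℂ) (u : A ⊗[ℂ] A) (b : A) :
    lapp φ (((1 : A) ⊗ₜ[ℂ] b) * u) = b * lapp φ u := by
  simpa [← Algebra.TensorProduct.one_def] using lapp_one_tmul_mul_mul φ u b 1

lemma lapp_tmul_one_mul (φ : A →ₗ[ℂ] ℂ) (u : A ⊗[ℂ] A) (b : A) :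
    lapp φ ((b ⊗ₜ[ℂ] (1 : A)) * u) = lapp (φ ∘ₗ LinearMap.mulLeft ℂ b) u := by
  simpa [← Algebra.TensorProduct.one_def, LinearMap.mulRight_one] using
    lapp_tmul_one_mul_mul φ u b 1

lemma lapp_map_id {φ : A →ₗ[ℂ] ℂ} {F : A →ₗ[ℂ] A} (u : A ⊗[ℂ] A) :
    lapp φ (TensorProduct.map F LinearMap.id u) = lapp (φ ∘ₗ F) u := by
  induction u with
  | zero => simp
  | add u v hu hv => simp only [map_add, hu, hv]
  | tmul a b => simp

end Contractions

namespace WeakHopfData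

variable {A : Type*} [NormedRing A] [StarRing A] [CStarRing A]
  [NormedAlgebra ℂ A] [StarModule ℂ A] [FiniteDimensional ℂ A] (W : WeakHopfData A)

lemma S_one : W.S 1 = 1 := by
  obtain ⟨y, hy⟩ := W.S.surjective 1
  have := W.S_antimul y 1
  rw [mul_one, hy, mul_one] at this
  exact this.symm

lemma coassoc_apply (x : A) :
    TensorProduct.assoc ℂ A A A (TensorProduct.map W.Δ LinearMap.id (W.Δ x))
      = TensorProduct.map LinearMap.id W.Δ (W.Δ x) :=
  LinearMap.congr_fun W.coassoc x

lemma lapp_ε (x : A) : lapp W.ε (W.Δ x) = x := LinearMap.congr_fun W.counit_left x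

lemma rapp_ε (x : A) : rapp W.ε (W.Δ x) = x := LinearMap.congr_fun W.counit_right x

lemma Δ_one_mul (x : A) : W.Δ 1 * W.Δ x = W.Δ x := by rw [← W.Δ_mul, one_mul]

lemma Δ_mul_one (x : A) : W.Δ x * W.Δ 1 = W.Δ x := by rw [← W.Δ_mul, mul_one]

lemma εL_eq (x : A) :
    W.εL x = LinearMap.mul' ℂ A (TensorProduct.map LinearMap.id W.S.toLinearMap (W.Δ x)) := rfl

lemma εR_eq (x : A) :
    W.εR x = LinearMap.mul' ℂ A (TensorProduct.map W.S.toLinearMap LinearMap.id (W.Δ x)) := rfl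

lemma εL_apply (x : A) : W.εL x = lapp (W.ε ∘ₗ LinearMap.mulRight ℂ x) (W.Δ 1) :=
  W.antipode_left x

lemma εR_apply (x : A) : W.εR x = rapp (W.ε ∘ₗ LinearMap.mulLeft ℂ x) (W.Δ 1) :=
  W.antipode_right x

lemma εL_one : W.εL 1 = 1 := by
  rw [εL_apply, LinearMap.mulRight_one, LinearMap.comp_id, lapp_ε]

lemma εR_one : W.εR 1 = 1 := by
  rw [εR_apply, LinearMap.mulLeft_one, LinearMap.comp_id, rapp_ε]

/-- Contracting the first leg of `(Δ ⊗ id) (Δ x)` amounts to applying `Δ` to a contraction. -/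
lemma Δ_lapp (φ : A →ₗ[ℂ] ℂ) (x : A) :
    W.Δ (lapp φ (W.Δ x)) = TensorProduct.lid ℂ (A ⊗[ℂ] A) (TensorProduct.map φ LinearMap.id
      (TensorProduct.assoc ℂ A A A (TensorProduct.map W.Δ LinearMap.id (W.Δ x)))) := by
  rw [coassoc_apply]
  induction W.Δ x with
  | zero => simp
  | tmul a b => simp
  | add u v hu hv => simp only [map_add, hu, hv]

lemma Δ_lapp_one (φ : A →ₗ[ℂ] ℂ) :
    W.Δ (lapp φ (W.Δ 1)) = (lapp φ (W.Δ 1) ⊗ₜ[ℂ] (1 : A)) * W.Δ 1 := by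
  rw [Δ_lapp, Δ_one_weak]
  generalize W.Δ 1 = v
  suffices H : ∀ u v : A ⊗[ℂ] A, TensorProduct.lid ℂ (A ⊗[ℂ] A) (TensorProduct.map φ LinearMap.id
      (TensorProduct.assoc ℂ A A A ((u ⊗ₜ[ℂ] (1 : A)) *
        ((TensorProduct.assoc ℂ A A A).symm ((1 : A) ⊗ₜ[ℂ] v)))))
        = (lapp φ u ⊗ₜ[ℂ] (1 : A)) * v from H v v
  intro u v
  induction u with
  | zero => simp
  | add u u' hu hu' => simp only [add_mul, map_add, TensorProduct.add_tmul, hu, hu']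
  | tmul a b =>
    induction v with
    | zero => simp
    | tmul c d => simp [TensorProduct.smul_tmul']
    | add v v' hv hv' => simp only [mul_add, map_add, TensorProduct.tmul_add, hv, hv']

lemma Δ_lapp_one' (φ : A →ₗ[ℂ] ℂ) :
    W.Δ (lapp φ (W.Δ 1)) = W.Δ 1 * (lapp φ (W.Δ 1) ⊗ₜ[ℂ] (1 : A)) := by
  rw [Δ_lapp, Δ_one_weak']
  generalize W.Δ 1 = v
  suffices H : ∀ u v : A ⊗[ℂ] A, TensorProduct.lid ℂ (A ⊗[ℂ] A) (TensorProduct.map φ LinearMap.id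
      (TensorProduct.assoc ℂ A A A (((TensorProduct.assoc ℂ A A A).symm ((1 : A) ⊗ₜ[ℂ] v)) *
        (u ⊗ₜ[ℂ] (1 : A))))) = v * (lapp φ u ⊗ₜ[ℂ] (1 : A)) from H v v
  intro u v
  induction u with
  | zero => simp
  | add u u' hu hu' => simp only [mul_add, map_add, TensorProduct.add_tmul, hu, hu']
  | tmul a b =>
    induction v with
    | zero => simp
    | tmul c d => simp [TensorProduct.smul_tmul']
    | add v v' hv hv' => simp only [add_mul, map_add, TensorProduct.tmul_add, hv, hv']

/-- The defining property of the left counital subalgebra in terms of the comultiplication. -/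
def IsLeft (l : A) : Prop :=
  W.Δ l = (l ⊗ₜ[ℂ] (1 : A)) * W.Δ 1 ∧ W.Δ l = W.Δ 1 * (l ⊗ₜ[ℂ] (1 : A))

lemma isLeft_lapp_one (φ : A →ₗ[ℂ] ℂ) : W.IsLeft (lapp φ (W.Δ 1)) :=
  ⟨W.Δ_lapp_one φ, W.Δ_lapp_one' φ⟩

lemma isLeft_εL (x : A) : W.IsLeft (W.εL x) := by
  rw [εL_apply]
  exact W.isLeft_lapp_one _

variable {W}

namespace IsLeft

lemma Δ_mul_left {l : A} (hl : W.IsLeft l) (x : A) :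
    W.Δ (l * x) = (l ⊗ₜ[ℂ] (1 : A)) * W.Δ x := by
  rw [W.Δ_mul, hl.1, mul_assoc, W.Δ_one_mul]

lemma Δ_mul_right {l : A} (hl : W.IsLeft l) (x : A) :
    W.Δ (x * l) = W.Δ x * (l ⊗ₜ[ℂ] (1 : A)) := by
  rw [W.Δ_mul, hl.2, ← mul_assoc, W.Δ_mul_one]

lemma mul {l m : A} (hl : W.IsLeft l) (hm : W.IsLeft m) : W.IsLeft (l * m) := by
  constructor
  · rw [hl.Δ_mul_left, hm.1, ← mul_assoc, Algebra.TensorProduct.tmul_mul_tmul, one_mul]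
  · rw [hm.Δ_mul_right, hl.2, mul_assoc, Algebra.TensorProduct.tmul_mul_tmul, one_mul]

lemma ringInverse {l : A} (hl : W.IsLeft l) (hu : IsUnit l) : W.IsLeft (Ring.inverse l) := by
  have h₁ := hl.Δ_mul_left (Ring.inverse l)
  have h₂ := hl.Δ_mul_right (Ring.inverse l)
  rw [Ring.mul_inverse_cancel l hu] at h₁
  rw [Ring.inverse_mul_cancel l hu] at h₂
  constructor
  · rw [h₁, ← mul_assoc, Algebra.TensorProduct.tmul_mul_tmul, one_mul,
      Ring.inverse_mul_cancel l hu, ← Algebra.TensorProduct.one_def, one_mul]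
  · rw [h₂, mul_assoc, Algebra.TensorProduct.tmul_mul_tmul, one_mul,
      Ring.mul_inverse_cancel l hu, ← Algebra.TensorProduct.one_def, mul_one]

end IsLeft

variable (W)

/-- Naturality of the flip composed with the antipode in both legs. -/
lemma comm_map_S_mul (u v : A ⊗[ℂ] A) :
    TensorProduct.comm ℂ A A (TensorProduct.map W.S.toLinearMap W.S.toLinearMap (u * v))
      = TensorProduct.comm ℂ A A (TensorProduct.map W.S.toLinearMap W.S.toLinearMap v)
        * TensorProduct.comm ℂ A A (TensorProduct.map W.S.toLinearMap W.S.toLinearMap u) := by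
  induction u with
  | zero => simp
  | add u u' hu hu' => simp only [mul_add, add_mul, map_add, hu, hu']
  | tmul a b =>
    induction v with
    | zero => simp
    | tmul c d => simp [W.S_antimul]
    | add v v' hv hv' => simp only [add_mul, mul_add, map_add, hv, hv']

/-- `S(x₍₁₎) x₍₂₎ ⊗ x₍₃₎ = 1₍₁₎ ⊗ x 1₍₂₎`. -/
lemma map_εR_id (x : A) :
    TensorProduct.map W.εR LinearMap.id (W.Δ x) = ((1 : A) ⊗ₜ[ℂ] x) * W.Δ 1 := by
  let F : A ⊗[ℂ] A →ₗ[ℂ] A := lapp W.ε ∘ₗ LinearMap.mulLeft ℂ (W.Δ x)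
  have h₁ : TensorProduct.map LinearMap.id F (TensorProduct.map LinearMap.id W.Δ (W.Δ 1))
      = ((1 : A) ⊗ₜ[ℂ] x) * W.Δ 1 := by
    generalize W.Δ 1 = u
    induction u with
    | zero => simp
    | add u u' hu hu' => simp only [mul_add, map_add, hu, hu']
    | tmul a b => simp [F, ← W.Δ_mul, W.lapp_ε]
  have h₂ : ∀ u v : A ⊗[ℂ] A, TensorProduct.map LinearMap.id F (TensorProduct.assoc ℂ A A A
      (((TensorProduct.assoc ℂ A A A).symm ((1 : A) ⊗ₜ[ℂ] v)) * (u ⊗ₜ[ℂ] (1 : A))))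
      = TensorProduct.map LinearMap.id (lapp W.ε ∘ₗ LinearMap.mulLeft ℂ (W.Δ x * v) ∘ₗ
          (TensorProduct.mk ℂ A A).flip 1) u := by
    intro u v
    induction u with
    | zero => simp
    | add u u' hu hu' => simp only [mul_add, map_add, TensorProduct.add_tmul, hu, hu']
    | tmul a b =>
      induction v with
      | zero => simp
      | tmul c d => simp [F]
      | add v v' hv hv' =>
        simp only [TensorProduct.map_tmul, LinearMap.comp_apply, LinearMap.mulLeft_apply] at hv hv'
        simp [add_mul, mul_add, TensorProduct.tmul_add, hv, hv']
  rw [← h₁, ← W.coassoc_apply, W.Δ_one_weak', h₂, W.Δ_mul_one]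
  generalize W.Δ x = u
  induction u with
  | zero => simp
  | add u u' hu hu' =>
    rw [map_add, hu, hu', ← LinearMap.add_apply, ← TensorProduct.map_add_right]
    congr 2
    ext b
    simp [add_mul]
  | tmul a b =>
    rw [TensorProduct.map_tmul, W.εR_apply]
    generalize W.Δ 1 = v
    induction v with
    | zero => simp
    | tmul c d => simp [TensorProduct.smul_tmul']
    | add v v' hv hv' => simp only [map_add, TensorProduct.add_tmul, hv, hv']

lemma IsLeft.εR_eq_S {l : A} (hl : W.IsLeft l) : W.εR l = W.S l := by
  have h : ∀ u : A ⊗[ℂ] A, LinearMap.mul' ℂ A (TensorProduct.map W.S.toLinearMap LinearMap.id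
      (u * (l ⊗ₜ[ℂ] (1 : A)))) = W.S l * LinearMap.mul' ℂ A
        (TensorProduct.map W.S.toLinearMap LinearMap.id u) := by
    intro u
    induction u with
    | zero => simp
    | tmul a b => simp [W.S_antimul, mul_assoc]
    | add u u' hu hu' => simp only [add_mul, mul_add, map_add, hu, hu']
  have h' := W.εR_one
  rw [εR_eq] at h'
  rw [εR_eq, hl.2, h, h', mul_one]

lemma ε_S_mul {l : A} (hl : W.IsLeft l) (x : A) : W.ε (W.S l * x) = W.ε (l * x) := by
  have h := W.ε_weak' l 1 x
  rw [mul_one] at h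
  rw [← IsLeft.εR_eq_S W hl, W.εR_apply, h]
  generalize W.Δ 1 = v
  induction v with
  | zero => simp
  | tmul a b => simp [mul_comm]
  | add u u' hu hu' => simp only [add_mul, map_add, hu, hu']

lemma Δ_one_eq_comm_map_S :
    W.Δ 1 = TensorProduct.comm ℂ A A (TensorProduct.map W.S.toLinearMap W.S.toLinearMap (W.Δ 1)) := by
  rw [← W.S_anticomul, W.S_one]

lemma rapp_one_congr {φ ψ : A →ₗ[ℂ] ℂ} (h : ∀ l, W.IsLeft l → φ l = ψ l) :
    rapp φ (W.Δ 1) = rapp ψ (W.Δ 1) := by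
  rw [← sub_eq_zero, ← Module.forall_dual_apply_eq_zero_iff ℂ]
  intro χ
  rw [map_sub, sub_eq_zero]
  simpa [apply_lapp] using h _ (W.isLeft_lapp_one χ)

lemma εL_eq_S_rapp (x : A) :
    W.εL x = W.S (rapp (W.ε ∘ₗ LinearMap.mulRight ℂ x) (W.Δ 1)) := by
  rw [← W.rapp_one_congr (φ := W.ε ∘ₗ LinearMap.mulRight ℂ x ∘ₗ W.S.toLinearMap)
    (fun l hl => by simpa using W.ε_S_mul hl x), εL_apply]
  conv_lhs => rw [Δ_one_eq_comm_map_S]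
  generalize W.Δ 1 = v
  induction v with
  | zero => simp
  | tmul c d => simp
  | add v v' hv hv' => simp only [map_add, hv, hv']

/-- `x₍₁₎ S(x₍₂₎) ⊗ x₍₃₎ = S(1₍₁₎) ⊗ 1₍₂₎ x`. -/
lemma map_εL_id (x : A) :
    TensorProduct.map W.εL LinearMap.id (W.Δ x)
      = TensorProduct.map W.S.toLinearMap LinearMap.id (W.Δ 1 * ((1 : A) ⊗ₜ[ℂ] x)) := by
  let F : A ⊗[ℂ] A →ₗ[ℂ] A := lapp W.ε ∘ₗ LinearMap.mulRight ℂ (W.Δ x)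
  have h₁ : TensorProduct.map W.S.toLinearMap F (TensorProduct.map LinearMap.id W.Δ (W.Δ 1))
      = TensorProduct.map W.S.toLinearMap LinearMap.id (W.Δ 1 * ((1 : A) ⊗ₜ[ℂ] x)) := by
    generalize W.Δ 1 = u
    induction u with
    | zero => simp
    | add u u' hu hu' => simp only [add_mul, map_add, hu, hu']
    | tmul a b => simp [F, ← W.Δ_mul, W.lapp_ε]
  have h₂ : ∀ u v : A ⊗[ℂ] A, TensorProduct.map W.S.toLinearMap F (TensorProduct.assoc ℂ A A A
      ((u ⊗ₜ[ℂ] (1 : A)) * ((TensorProduct.assoc ℂ A A A).symm ((1 : A) ⊗ₜ[ℂ] v))))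
      = TensorProduct.map W.S.toLinearMap (lapp W.ε ∘ₗ LinearMap.mulRight ℂ (v * W.Δ x) ∘ₗ
          (TensorProduct.mk ℂ A A).flip 1) u := by
    intro u v
    induction u with
    | zero => simp
    | add u u' hu hu' => simp only [add_mul, map_add, TensorProduct.add_tmul, hu, hu']
    | tmul a b =>
      induction v with
      | zero => simp
      | tmul c d => simp [F]
      | add v v' hv hv' =>
        simp only [TensorProduct.map_tmul, LinearMap.comp_apply, LinearMap.mulRight_apply] at hv hv'
        simp [add_mul, mul_add, TensorProduct.tmul_add, hv, hv']
  rw [← h₁, ← W.coassoc_apply, W.Δ_one_weak, h₂, W.Δ_one_mul]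
  generalize W.Δ x = u
  induction u with
  | zero => simp
  | add u u' hu hu' =>
    rw [map_add, hu, hu', ← LinearMap.add_apply, ← TensorProduct.map_add_right]
    congr 2
    ext b
    simp [mul_add]
  | tmul a b =>
    rw [TensorProduct.map_tmul, W.εL_eq_S_rapp]
    generalize W.Δ 1 = v
    induction v with
    | zero => simp
    | tmul c d => simp [TensorProduct.smul_tmul']
    | add v v' hv hv' => simp only [map_add, TensorProduct.add_tmul, hv, hv']

lemma map_S_εL (x : A) :
    LinearMap.mul' ℂ A (TensorProduct.map W.S.toLinearMap W.εL (W.Δ x)) = W.S x := by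
  let F : A ⊗[ℂ] (A ⊗[ℂ] A) →ₗ[ℂ] A := LinearMap.mul' ℂ A ∘ₗ TensorProduct.map W.S.toLinearMap
    (LinearMap.mul' ℂ A ∘ₗ TensorProduct.map LinearMap.id W.S.toLinearMap)
  have h₁ : ∀ u : A ⊗[ℂ] A, F (TensorProduct.map LinearMap.id W.Δ u)
      = LinearMap.mul' ℂ A (TensorProduct.map W.S.toLinearMap W.εL u) := by
    intro u
    induction u with
    | zero => simp
    | tmul a b => simp [F, εL]
    | add u u' hu hu' => simp only [map_add, hu, hu']
  have h₂ : ∀ u : A ⊗[ℂ] A, F (TensorProduct.assoc ℂ A A A (TensorProduct.map W.Δ LinearMap.id u))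
      = LinearMap.mul' ℂ A (TensorProduct.map LinearMap.id W.S.toLinearMap
          (TensorProduct.map W.εR LinearMap.id u)) := by
    intro u
    induction u with
    | zero => simp
    | add u u' hu hu' => simp only [map_add, hu, hu']
    | tmul a b =>
      rw [TensorProduct.map_tmul, TensorProduct.map_tmul, εR_eq]
      generalize W.Δ a = v
      induction v with
      | zero => simp
      | tmul c d => simp [F, mul_assoc]
      | add v v' hv hv' => simp only [map_add, TensorProduct.add_tmul, hv, hv']
  rw [← h₁, ← W.coassoc_apply, h₂, W.map_εR_id]
  have h₃ : ∀ u : A ⊗[ℂ] A, LinearMap.mul' ℂ A (TensorProduct.map LinearMap.id W.S.toLinearMap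
      (((1 : A) ⊗ₜ[ℂ] x) * u)) = LinearMap.mul' ℂ A
        (TensorProduct.map LinearMap.id W.S.toLinearMap u) * W.S x := by
    intro u
    induction u with
    | zero => simp
    | tmul a b => simp [W.S_antimul, mul_assoc]
    | add u u' hu hu' => simp only [add_mul, mul_add, map_add, hu, hu']
  have h₄ := W.εL_one
  rw [εL_eq] at h₄
  rw [h₃, h₄, one_mul]

/-- The pulling-through property of a left integral. -/
lemma S_tmul_one_mul_Δ {h : A} (hh : ∀ x, x * h = W.εL x * h) (x : A) :
    (W.S x ⊗ₜ[ℂ] (1 : A)) * W.Δ h = ((1 : A) ⊗ₜ[ℂ] x) * W.Δ h := by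
  let Q : A ⊗[ℂ] (A ⊗[ℂ] A) →ₗ[ℂ] A ⊗[ℂ] A := LinearMap.mulRight ℂ (W.Δ h) ∘ₗ
    TensorProduct.map (LinearMap.mul' ℂ A) LinearMap.id ∘ₗ
    (TensorProduct.assoc ℂ A A A).symm.toLinearMap ∘ₗ
    TensorProduct.map W.S.toLinearMap LinearMap.id
  have h₁ : ∀ u : A ⊗[ℂ] A, Q (TensorProduct.map LinearMap.id W.Δ u)
      = (LinearMap.mul' ℂ A (TensorProduct.map W.S.toLinearMap W.εL u) ⊗ₜ[ℂ] (1 : A)) * W.Δ h := by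
    intro u
    induction u with
    | zero => simp
    | add u u' hu hu' => simp only [add_mul, map_add, TensorProduct.add_tmul, hu, hu']
    | tmul a b =>
      have e : ∀ v : A ⊗[ℂ] A, Q (a ⊗ₜ[ℂ] v) = (W.S a ⊗ₜ[ℂ] (1 : A)) * (v * W.Δ h) := by
        intro v
        induction v with
        | zero => simp
        | tmul c d => simp [Q, ← mul_assoc]
        | add v v' hv hv' => simp only [map_add, TensorProduct.tmul_add, add_mul, mul_add, hv, hv']
      rw [TensorProduct.map_tmul, LinearMap.id_apply, e, ← W.Δ_mul, hh,
        (W.isLeft_εL b).Δ_mul_left, ← mul_assoc, Algebra.TensorProduct.tmul_mul_tmul, mul_one,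
        TensorProduct.map_tmul, LinearMap.mul'_apply]
      rfl
  have h₂ : ∀ u : A ⊗[ℂ] A, Q (TensorProduct.assoc ℂ A A A (TensorProduct.map W.Δ LinearMap.id u))
      = TensorProduct.map W.εR LinearMap.id u * W.Δ h := by
    intro u
    induction u with
    | zero => simp
    | add u u' hu hu' => simp only [map_add, add_mul, hu, hu']
    | tmul a b =>
      rw [TensorProduct.map_tmul, TensorProduct.map_tmul, εR_eq]
      generalize W.Δ a = v
      induction v with
      | zero => simp
      | tmul c d => simp [Q]
      | add v v' hv hv' => simp only [map_add, TensorProduct.add_tmul, add_mul, hv, hv']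
  rw [← W.map_S_εL x, ← h₁, ← W.coassoc_apply, h₂, W.map_εR_id, mul_assoc, W.Δ_one_mul]

lemma Δ_mul_tmul_one {h : A} (hh : ∀ x, x * h = W.εL x * h) (hS : W.S h = h) (x : A) :
    W.Δ h * (x ⊗ₜ[ℂ] (1 : A)) = W.Δ h * ((1 : A) ⊗ₜ[ℂ] W.S x) := by
  obtain ⟨y, rfl⟩ := W.S.surjective x
  have := congrArg (fun u => TensorProduct.comm ℂ A A
    (TensorProduct.map W.S.toLinearMap W.S.toLinearMap u)) (W.S_tmul_one_mul_Δ hh y)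
  simp only [comm_map_S_mul, ← W.S_anticomul, hS] at this
  simpa [W.S_one] using this.symm

end WeakHopfData

lemma commute_ringInverse_right {M₀ : Type*} [MonoidWithZero M₀] {a b : M₀} (h : Commute a b) :
    Commute a (Ring.inverse b) := by
  by_cases hb : IsUnit b
  · obtain ⟨u, rfl⟩ := hb
    rw [Ring.inverse_unit]
    exact h.units_inv_right
  · rw [Ring.inverse_non_unit b hb]
    exact Commute.zero_right a

lemma IsPosElem.star_eq {R : Type*} [Mul R] [StarMul R] {a : R} (ha : IsPosElem a) :
    star a = a := by
  obtain ⟨y, rfl⟩ := ha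
  simp

section Positivity

variable {A : Type*} [NormedRing A] [StarRing A] [CStarRing A]
  [NormedAlgebra ℂ A] [StarModule ℂ A] [FiniteDimensional ℂ A]

/-- A finite-dimensional `C*`-algebra in the unbundled sense is a `CStarAlgebra`. -/
abbrev cstarAlgebraOfFiniteDimensional : CStarAlgebra A :=
  { (inferInstance : NormedRing A), (inferInstance : StarRing A),
    (inferInstance : NormedAlgebra ℂ A) with
    complete := (FiniteDimensional.complete ℂ A).complete
    norm_mul_self_le := CStarRing.norm_mul_self_le
    star_smul := star_smul }

attribute [local instance] cstarAlgebraOfFiniteDimensional CStarAlgebra.spectralOrder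
  CStarAlgebra.spectralOrderedRing

lemma isPosElem_iff_nonneg {a : A} : IsPosElem a ↔ 0 ≤ a :=
  CStarAlgebra.nonneg_iff_eq_star_mul_self.symm

namespace IsPosElem

lemma eq_of_mul_self_eq {a b : A} (ha : IsPosElem a) (hb : IsPosElem b) (h : a * a = b * b) :
    a = b := by
  rw [isPosElem_iff_nonneg] at ha hb
  rw [← CFC.sqrt_unique h ha, CFC.sqrt_mul_self b hb]

lemma mul {a b : A} (ha : IsPosElem a) (hb : IsPosElem b) (h : Commute a b) :
    IsPosElem (a * b) := by
  rw [isPosElem_iff_nonneg] at *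
  exact h.mul_nonneg ha hb

lemma commute_of_mul_self {a x : A} (ha : IsPosElem a) (h : Commute (a * a) x) :
    Commute a x := by
  rw [isPosElem_iff_nonneg] at ha
  have := h.cfcₙ_nnreal NNReal.sqrt
  rwa [← CFC.sqrt, CFC.sqrt_mul_self a ha] at this

end IsPosElem

lemma isPosElem_sum_star_mul_self {κ : Type*} (s : Finset κ) (b : κ → A) :
    IsPosElem (∑ k ∈ s, star (b k) * b k) :=
  isPosElem_iff_nonneg.2 (Finset.sum_nonneg fun k _ => star_mul_self_nonneg (b k))

lemma eq_zero_of_sum_star_mul_self_mul_eq_zero {κ : Type*} {s : Finset κ} {b : κ → A} {y : A}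
    (h : (∑ k ∈ s, star (b k) * b k) * y = 0) {k : κ} (hk : k ∈ s) : b k * y = 0 := by
  have h₁ : ∑ k ∈ s, star (b k * y) * (b k * y) = 0 := by
    calc _ = star y * ((∑ k ∈ s, star (b k) * b k) * y) := by
          simp only [star_mul, Finset.mul_sum, Finset.sum_mul, mul_assoc]
      _ = 0 := by rw [h, mul_zero]
  have h₂ := (Finset.sum_eq_zero_iff_of_nonneg
    fun k _ => star_mul_self_nonneg (b k * y)).1 h₁ k hk
  exact CStarRing.star_mul_self_eq_zero_iff _ |>.1 h₂

lemma isUnit_of_forall_commute {a : A} (hc : ∀ x, Commute a x) (h : ∀ y, a * y = 0 → y = 0) :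
    IsUnit a := by
  have hinj : Function.Injective (LinearMap.mulLeft ℂ a) :=
    (injective_iff_map_eq_zero _).2 h
  obtain ⟨z, hz⟩ := LinearMap.injective_iff_surjective.1 hinj 1
  exact isUnit_iff_exists.2 ⟨z, hz, (hc z).eq ▸ hz⟩

end Positivity

lemma InnerProductSpace.Core.exists_orthonormal {V : Type*} [AddCommGroup V] [Module ℂ V]
    [FiniteDimensional ℂ V] (c : InnerProductSpace.Core ℂ V) :
    ∃ (n : ℕ) (f : Fin n → V), (∀ x, ∑ i, c.inner (f i) x • f i = x) ∧
      ∀ i j, c.inner (f i) (f j) = if i = j then 1 else 0 := by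
  let := c.toNormedAddCommGroup
  let := InnerProductSpace.ofCore c.toCore
  let b := stdOrthonormalBasis ℂ V
  exact ⟨_, b, fun x => b.sum_repr' x, fun i j => orthonormal_iff_ite.1 b.orthonormal i j⟩

namespace HaarPkg

variable {A : Type*} [NormedRing A] [StarRing A] [CStarRing A]
  [NormedAlgebra ℂ A] [StarModule ℂ A] [FiniteDimensional ℂ A] (P : HaarPkg A)

lemma gL_isLeft : P.W.IsLeft P.gL := by
  obtain ⟨x, hx⟩ := P.gL_mem
  exact hx ▸ P.W.isLeft_εL x

lemma inv_gL_isLeft : P.W.IsLeft (Ring.inverse P.gL) := P.gL_isLeft.ringInverse P.gL_unit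

lemma S_inverse {x : A} (hx : IsUnit x) :
    P.W.S (Ring.inverse x) = Ring.inverse (P.W.S x) := by
  have h₁ := P.W.S_antimul x (Ring.inverse x)
  have h₂ := P.W.S_antimul (Ring.inverse x) x
  rw [Ring.mul_inverse_cancel x hx, P.W.S_one] at h₁
  rw [Ring.inverse_mul_cancel x hx, P.W.S_one] at h₂
  exact (Ring.inverse_unit ⟨P.W.S x, P.W.S (Ring.inverse x), h₂.symm, h₁.symm⟩).symm

lemma S_gL : P.W.S P.gL = P.gR := P.gR_S.symm

lemma commute_gL_gR : Commute P.gL P.gR := P.gLR_comm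

lemma commute_gL_inv_gR : Commute P.gL (Ring.inverse P.gR) := commute_ringInverse_right P.commute_gL_gR

lemma S_gR : P.W.S P.gR = P.gL := by
  rw [gR_S, P.S_sq, (Commute.refl _).mul_left P.commute_gL_inv_gR.symm |>.eq, mul_assoc,
    Ring.mul_inverse_cancel _ P.g_unit, mul_one]

lemma S_inv_gL : P.W.S (Ring.inverse P.gL) = Ring.inverse P.gR := by
  rw [P.S_inverse P.gL_unit, S_gL]

lemma S_inv_gR : P.W.S (Ring.inverse P.gR) = Ring.inverse P.gL := by
  rw [P.S_inverse P.gR_unit, S_gR]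

lemma tmul_one_mul_Δ_h (x : A) :
    (P.W.S x ⊗ₜ[ℂ] (1 : A)) * P.W.Δ P.h = ((1 : A) ⊗ₜ[ℂ] x) * P.W.Δ P.h :=
  P.W.S_tmul_one_mul_Δ P.haar_left x

lemma Δ_h_mul_tmul_one (x : A) :
    P.W.Δ P.h * (x ⊗ₜ[ℂ] (1 : A)) = P.W.Δ P.h * ((1 : A) ⊗ₜ[ℂ] P.W.S x) :=
  P.W.Δ_mul_tmul_one P.haar_left P.haar_S x

/-- The basic contraction `⟨ĥ, S(b) h₍₁₎ a⟩ h₍₂₎ = b gR² S(a)`. -/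
lemma lapp_hHat (a b : A) :
    lapp (P.hHat ∘ₗ LinearMap.mulRight ℂ a ∘ₗ LinearMap.mulLeft ℂ (P.W.S b)) (P.W.Δ P.h)
      = b * (P.gR * P.gR) * P.W.S a := by
  rw [← lapp_tmul_one_mul_mul, tmul_one_mul_Δ_h, mul_assoc, Δ_h_mul_tmul_one, ← mul_assoc,
    lapp_one_tmul_mul_mul, ← P.gR_sq]

lemma lapp_hHat_left (b : A) :
    lapp (P.hHat ∘ₗ LinearMap.mulLeft ℂ (P.W.S b)) (P.W.Δ P.h) = b * (P.gR * P.gR) := by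
  simpa [P.W.S_one, LinearMap.mulRight_one] using P.lapp_hHat 1 b

lemma lapp_hHat_right (a : A) :
    lapp (P.hHat ∘ₗ LinearMap.mulRight ℂ a) (P.W.Δ P.h) = P.gR * P.gR * P.W.S a := by
  simpa [P.W.S_one, LinearMap.mulLeft_one] using P.lapp_hHat a 1

/-- The modular automorphism of `ĥ`. -/
lemma hHat_S_S_mul (x y : A) :
    P.hHat (P.W.S (P.W.S x) * y)
      = P.hHat (y * (P.gL * P.gL * x * (Ring.inverse P.gL * Ring.inverse P.gL))) := by
  obtain ⟨_, φ, -, rfl⟩ := P.haar_nondeg y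
  have h₁ := congrArg φ (P.lapp_hHat_left (P.W.S x))
  have h₂ := congrArg φ (P.lapp_hHat_right
    (P.gL * P.gL * x * (Ring.inverse P.gL * Ring.inverse P.gL)))
  have h₃ : P.gR * P.gR * P.W.S (P.gL * P.gL * x * (Ring.inverse P.gL * Ring.inverse P.gL))
      = P.W.S x * (P.gR * P.gR) := by
    simp only [P.W.S_antimul, S_gL, S_inv_gL, mul_assoc,
      Ring.mul_inverse_cancel_left _ _ P.gR_unit]
  rw [h₃, ← h₁, apply_lapp, apply_lapp] at h₂
  exact h₂.symm

lemma eq_zero_of_forall_hHat {x : A} (h : ∀ y, P.hHat (y * x) = 0) : x = 0 := by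
  have h₁ : P.hHat ∘ₗ LinearMap.mulRight ℂ x = 0 := by
    ext y
    exact h y
  have h₂ := P.lapp_hHat_right x
  have h₃ : lapp (0 : A →ₗ[ℂ] ℂ) (P.W.Δ P.h) = 0 := by simp [lapp]
  rw [h₁, h₃, mul_assoc] at h₂
  have h₄ : P.W.S x = 0 := by
    have := (P.gR_unit.mul_right_eq_zero).1 h₂.symm
    exact (P.gR_unit.mul_right_eq_zero).1 this
  simpa using h₄

lemma hHat_star (x : A) : P.hHat (star x) = starRingEnd ℂ (P.hHat x) := by
  obtain ⟨r, -, hr⟩ := P.hHat_pos (1 + x)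
  obtain ⟨s, -, hs⟩ := P.hHat_pos (1 + Complex.I • x)
  obtain ⟨t, -, ht⟩ := P.hHat_pos x
  obtain ⟨u, -, hu⟩ := P.hHat_pos 1
  simp only [star_add, star_one, star_smul, add_mul, mul_add, one_mul, mul_one, map_add,
    smul_mul_assoc, mul_smul_comm, map_smul, smul_eq_mul, Complex.star_def, Complex.conj_I,
    ht] at hr hs hu
  rw [hu] at hr hs
  have hr' := congrArg Complex.im hr
  have hs' := congrArg Complex.im hs
  simp at hr' hs'
  apply Complex.ext
  · simp; linarith
  · simp; linarith

/-- The inner product `⟨x, y⟩ = ⟨ĥ, x* y⟩`. -/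
abbrev preInnerCore : PreInnerProductSpace.Core ℂ A where
  inner x y := P.hHat (star x * y)
  conj_inner_symm x y := by rw [← hHat_star]; simp
  re_inner_nonneg x := by
    obtain ⟨r, hr, h⟩ := P.hHat_pos x
    simpa [h] using hr
  add_left x y z := by simp [add_mul]
  smul_left x y r := by simp

/-- `preInnerCore` is definite, by Cauchy–Schwarz and the faithfulness of `ĥ`. -/
abbrev innerCore : InnerProductSpace.Core ℂ A where
  __ := P.preInnerCore
  definite x hx := by
    refine P.eq_zero_of_forall_hHat fun y => ?_
    have h := @InnerProductSpace.Core.inner_mul_inner_self_le ℂ A _ _ _ P.preInnerCore (star y) x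
    change ‖P.hHat (star (star y) * x)‖ * ‖P.hHat (star x * star y)‖
      ≤ _ * (P.hHat (star x * x)).re at h
    have hx' : P.hHat (star x * x) = 0 := hx
    have hs : ‖P.hHat (star x * star y)‖ = ‖P.hHat (y * x)‖ := by
      rw [← star_mul, hHat_star, Complex.norm_conj]
    rw [hx', hs, star_star, Complex.zero_re, mul_zero] at h
    exact norm_eq_zero.1 (mul_self_eq_zero.1 (le_antisymm h (mul_self_nonneg _)))

lemma exists_orthonormal : ∃ (n : ℕ) (f : Fin n → A),
    (∀ x, ∑ i, P.hHat (star (f i) * x) • f i = x) ∧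
    ∀ i j, P.hHat (star (f i) * f j) = if i = j then 1 else 0 :=
  P.innerCore.exists_orthonormal

end HaarPkg

namespace WeakHopfData

variable {A : Type*} [NormedRing A] [StarRing A] [CStarRing A]
  [NormedAlgebra ℂ A] [StarModule ℂ A] [FiniteDimensional ℂ A] (W : WeakHopfData A)

lemma mul_map_id_S_one_tmul_mul (y : A) (u : A ⊗[ℂ] A) :
    LinearMap.mul' ℂ A (TensorProduct.map LinearMap.id W.S.toLinearMap (((1 : A) ⊗ₜ[ℂ] y) * u))
      = LinearMap.mul' ℂ A (TensorProduct.map LinearMap.id W.S.toLinearMap u) * W.S y := by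
  induction u with
  | zero => simp
  | tmul a b => simp [W.S_antimul, mul_assoc]
  | add u u' hu hu' => simp only [add_mul, mul_add, map_add, hu, hu']

lemma mul_map_id_S_tmul_one_mul (y : A) (u : A ⊗[ℂ] A) :
    LinearMap.mul' ℂ A (TensorProduct.map LinearMap.id W.S.toLinearMap ((y ⊗ₜ[ℂ] (1 : A)) * u))
      = y * LinearMap.mul' ℂ A (TensorProduct.map LinearMap.id W.S.toLinearMap u) := by
  induction u with
  | zero => simp
  | tmul a b => simp [mul_assoc]
  | add u u' hu hu' => simp only [mul_add, map_add, hu, hu']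

end WeakHopfData

namespace HaarPkg

variable {A : Type*} [NormedRing A] [StarRing A] [CStarRing A]
  [NormedAlgebra ℂ A] [StarModule ℂ A] [FiniteDimensional ℂ A] (P : HaarPkg A)

lemma iotaEl_eq : P.iotaEl = LinearMap.mul' ℂ A (TensorProduct.map LinearMap.id
    P.W.S.toLinearMap (P.W.Δ P.h * ((Ring.inverse P.gL * Ring.inverse P.gL) ⊗ₜ[ℂ] (1 : A)))) := by
  rw [iotaEl, P.W.εL_eq, (P.inv_gL_isLeft.mul P.inv_gL_isLeft).Δ_mul_right]

lemma iotaEl_isLeft : P.W.IsLeft P.iotaEl := P.W.isLeft_εL _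

lemma commute_iotaEl (x : A) : Commute P.iotaEl x := by
  obtain ⟨y, rfl⟩ := P.W.S.surjective x
  have h := P.tmul_one_mul_Δ_h y
  rw [iotaEl_eq, Commute, SemiconjBy, ← P.W.mul_map_id_S_one_tmul_mul, ← mul_assoc, ← h,
    mul_assoc, P.W.mul_map_id_S_tmul_one_mul]

lemma inv_gL_sq_mul_S_lapp (x : A) :
    Ring.inverse P.gL * Ring.inverse P.gL *
      P.W.S (lapp (P.hHat ∘ₗ LinearMap.mulLeft ℂ x) (P.W.Δ P.h)) = x := by
  obtain ⟨y, rfl⟩ := P.W.S.surjective x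
  rw [lapp_hHat_left, P.W.S_antimul, P.W.S_antimul, S_gR]
  simp only [mul_assoc, Ring.inverse_mul_cancel_left _ _ P.gL_unit]

lemma iotaEl_eq_sum {n : ℕ} {f : Fin n → A}
    (hf : ∀ x, ∑ i, P.hHat (star (f i) * x) • f i = x) :
    P.iotaEl = ∑ i, f i * star (f i) := by
  have h : ∀ u : A ⊗[ℂ] A, LinearMap.mul' ℂ A (TensorProduct.map LinearMap.id
      P.W.S.toLinearMap (u * ((Ring.inverse P.gL * Ring.inverse P.gL) ⊗ₜ[ℂ] (1 : A))))
      = ∑ i, f i * (Ring.inverse P.gL * Ring.inverse P.gL *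
        P.W.S (lapp (P.hHat ∘ₗ LinearMap.mulLeft ℂ (star (f i))) u)) := by
    intro u
    induction u with
    | zero => simp
    | add u u' hu hu' =>
      simp only [add_mul, mul_add, map_add, hu, hu', Finset.sum_add_distrib]
    | tmul a b =>
      conv_lhs => rw [← hf a]
      simp [Finset.sum_mul, TensorProduct.sum_tmul, mul_assoc]
  rw [iotaEl_eq, h]
  simp only [inv_gL_sq_mul_S_lapp]

lemma iotaEl_pos : IsPosElem P.iotaEl := by
  obtain ⟨n, f, hf, -⟩ := P.exists_orthonormal
  rw [P.iotaEl_eq_sum hf]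
  simpa using isPosElem_sum_star_mul_self Finset.univ fun i => star (f i)

lemma iotaEl_isUnit : IsUnit P.iotaEl := by
  obtain ⟨n, f, hf, -⟩ := P.exists_orthonormal
  refine isUnit_of_forall_commute P.commute_iotaEl fun y hy => ?_
  have h : ∀ i, star (f i) * y = 0 := fun i =>
    eq_zero_of_sum_star_mul_self_mul_eq_zero (s := Finset.univ) (b := fun i => star (f i))
      (by simpa [P.iotaEl_eq_sum hf] using hy) (Finset.mem_univ i)
  have h₁ : star (∑ i, P.hHat (star (f i) * 1) • f i) * y = 0 := by
    simp only [star_sum, star_smul, Finset.sum_mul, smul_mul_assoc, h, smul_zero,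
      Finset.sum_const_zero]
  rwa [hf 1, star_one, one_mul] at h₁

lemma inverse_g : Ring.inverse P.g = P.gR * Ring.inverse P.gL := by
  refine Ring.inverse_unit ⟨P.g, P.gR * Ring.inverse P.gL, ?_, ?_⟩
  · rw [g, mul_assoc, Ring.inverse_mul_cancel_left _ _ P.gR_unit,
      Ring.mul_inverse_cancel _ P.gL_unit]
  · rw [g, mul_assoc, Ring.inverse_mul_cancel_left _ _ P.gL_unit,
      Ring.mul_inverse_cancel _ P.gR_unit]

lemma commute_gR_inv_gL : Commute P.gR (Ring.inverse P.gL) :=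
  commute_ringInverse_right P.commute_gL_gR.symm

lemma inverse_g_mul_mul_inverse_g : Ring.inverse P.g * (Ring.inverse P.gR * Ring.inverse P.gR) *
    Ring.inverse P.g = Ring.inverse P.gL * Ring.inverse P.gL := by
  nth_rewrite 1 [inverse_g, P.commute_gR_inv_gL.eq]
  simp only [inverse_g, mul_assoc, Ring.mul_inverse_cancel_left _ _ P.gR_unit,
    Ring.inverse_mul_cancel_left _ _ P.gR_unit]

lemma S_iotaEl : P.W.S P.iotaEl = P.iotaEl := by
  have hg : P.W.S P.g = Ring.inverse P.g := P.g_S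
  have hu : IsUnit P.g := P.g_unit
  have h₁ : ∀ u : A ⊗[ℂ] A, P.W.S (LinearMap.mul' ℂ A (TensorProduct.map LinearMap.id
      P.W.S.toLinearMap (u * ((Ring.inverse P.gL * Ring.inverse P.gL) ⊗ₜ[ℂ] (1 : A)))))
      = LinearMap.mul' ℂ A (TensorProduct.map (LinearMap.mulRight ℂ (Ring.inverse P.gR *
        Ring.inverse P.gR) ∘ₗ P.W.S.toLinearMap ∘ₗ P.W.S.toLinearMap) P.W.S.toLinearMap
        (TensorProduct.comm ℂ A A u)) := by
    intro u
    induction u with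
    | zero => simp
    | add u u' hu hu' => simp only [add_mul, map_add, hu, hu']
    | tmul a b => simp [P.W.S_antimul, S_inv_gL, mul_assoc]
  have h₂ : ∀ u : A ⊗[ℂ] A, LinearMap.mul' ℂ A (TensorProduct.map (LinearMap.mulRight ℂ
        (Ring.inverse P.gR * Ring.inverse P.gR) ∘ₗ P.W.S.toLinearMap ∘ₗ P.W.S.toLinearMap)
        P.W.S.toLinearMap (TensorProduct.map LinearMap.id
          (LinearMap.mulLeft ℂ P.g ∘ₗ LinearMap.mulRight ℂ P.g) u))
      = P.g * LinearMap.mul' ℂ A (TensorProduct.map LinearMap.id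
      P.W.S.toLinearMap (u * ((Ring.inverse P.gL * Ring.inverse P.gL) ⊗ₜ[ℂ] (1 : A))))
        * Ring.inverse P.g := by
    intro u
    induction u with
    | zero => simp
    | add u u' hu hu' => simp only [add_mul, mul_add, map_add, hu, hu']
    | tmul a b =>
      have := P.S_sq a
      change P.W.S (P.W.S a) = P.g * a * Ring.inverse P.g at this
      simp [P.W.S_antimul, hg, this, ← inverse_g_mul_mul_inverse_g, mul_assoc]
  have h₃ := P.haar_flip
  change TensorProduct.map LinearMap.id (LinearMap.mulLeft ℂ P.g ∘ₗ LinearMap.mulRight ℂ P.g) _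
    = _ at h₃
  rw [iotaEl_eq, h₁, ← h₃, h₂, ← iotaEl_eq, ← (P.commute_iotaEl P.g).eq, mul_assoc,
    Ring.mul_inverse_cancel _ hu, mul_one]

end HaarPkg

namespace WeakHopfData

variable {A : Type*} [NormedRing A] [StarRing A] [CStarRing A]
  [NormedAlgebra ℂ A] [StarModule ℂ A] [FiniteDimensional ℂ A] (W : WeakHopfData A)

lemma εR_eq_self {r : A} (hr : W.Δ r = W.Δ 1 * ((1 : A) ⊗ₜ[ℂ] r)) : W.εR r = r := by
  have h : ∀ u : A ⊗[ℂ] A, LinearMap.mul' ℂ A (TensorProduct.map W.S.toLinearMap LinearMap.id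
      (u * ((1 : A) ⊗ₜ[ℂ] r))) = LinearMap.mul' ℂ A
        (TensorProduct.map W.S.toLinearMap LinearMap.id u) * r := by
    intro u
    induction u with
    | zero => simp
    | tmul a b => simp [mul_assoc]
    | add u u' hu hu' => simp only [add_mul, map_add, hu, hu']
  have h' := W.εR_one
  rw [εR_eq] at h'
  rw [εR_eq, hr, h, h', one_mul]

lemma IsLeft.Δ_S {l : A} (hl : W.IsLeft l) : W.Δ (W.S l) = W.Δ 1 * ((1 : A) ⊗ₜ[ℂ] W.S l) := by
  rw [W.S_anticomul, hl.1, comm_map_S_mul, ← Δ_one_eq_comm_map_S]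
  simp [W.S_one]

lemma rapp_one_eq_S_lapp (φ : A →ₗ[ℂ] ℂ) :
    rapp φ (W.Δ 1) = W.S (lapp (φ ∘ₗ W.S.toLinearMap) (W.Δ 1)) := by
  conv_lhs => rw [Δ_one_eq_comm_map_S]
  induction W.Δ 1 with
  | zero => simp
  | tmul a b => simp
  | add u v hu hv => simp only [map_add, hu, hv]

lemma εR_rapp_one (φ : A →ₗ[ℂ] ℂ) : W.εR (rapp φ (W.Δ 1)) = rapp φ (W.Δ 1) := by
  rw [rapp_one_eq_S_lapp]
  exact W.εR_eq_self (IsLeft.Δ_S W (W.isLeft_lapp_one _))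

lemma lapp_Δ_rapp (φ ψ : A →ₗ[ℂ] ℂ) (x : A) :
    lapp ψ (W.Δ (rapp φ (W.Δ x))) = rapp φ (W.Δ (lapp ψ (W.Δ x))) := by
  rw [Δ_lapp]
  induction W.Δ x with
  | zero => simp
  | add u v hu hv => simp only [map_add, hu, hv]
  | tmul a b =>
    simp only [rapp_tmul, map_smul, TensorProduct.map_tmul, LinearMap.id_coe, id_eq]
    induction W.Δ a with
    | zero => simp
    | add u v hu hv => simp only [map_add, smul_add, TensorProduct.add_tmul, hu, hv]
    | tmul c d => simp [smul_smul, mul_comm]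

/-- The star operation on `A ⊗ A` as an additive homomorphism. -/
def starTHom : A ⊗[ℂ] A →+ A ⊗[ℂ] A := AddMonoidHom.mk' W.starT W.starT_add

end WeakHopfData

namespace HaarPkg

variable {A : Type*} [NormedRing A] [StarRing A] [CStarRing A]
  [NormedAlgebra ℂ A] [StarModule ℂ A] [FiniteDimensional ℂ A] (P : HaarPkg A)

lemma jayEl_eq : P.jayEl = lapp (P.hHat ∘ₗ LinearMap.mulLeft ℂ
    (Ring.inverse P.gL * Ring.inverse P.gL)) (P.W.Δ 1) := by
  rw [jayEl, (P.inv_gL_isLeft.mul P.inv_gL_isLeft).1, lapp_tmul_one_mul]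

lemma jayEl_isLeft : P.W.IsLeft P.jayEl := by
  rw [jayEl_eq]
  exact P.W.isLeft_lapp_one _

lemma S_S_inv_gL_sq : P.W.S (P.W.S (Ring.inverse P.gL * Ring.inverse P.gL))
    = Ring.inverse P.gL * Ring.inverse P.gL := by
  simp only [P.W.S_antimul, S_inv_gL, S_inv_gR]

lemma hHat_mul_S_mul (u v : A) :
    P.hHat (u * P.W.S v * (Ring.inverse P.gR * Ring.inverse P.gR))
      = P.hHat (Ring.inverse P.gL * Ring.inverse P.gL * (P.W.S u * v)) := by
  have h₁ := P.hHat_S_S_mul (Ring.inverse P.gL * Ring.inverse P.gL) (P.W.S u * v)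
  have h₂ := P.hHat_S_S_mul (Ring.inverse P.gL * Ring.inverse P.gL * v) (P.W.S u)
  rw [S_S_inv_gL_sq] at h₁
  rw [P.W.S_antimul, P.W.S_antimul, S_S_inv_gL_sq] at h₂
  rw [h₁, ← P.hHat_S, P.W.S_antimul, P.W.S_antimul, P.W.S_antimul, S_inv_gR, ← mul_assoc, h₂]
  simp only [mul_assoc, Ring.mul_inverse_cancel_left _ _ P.gL_unit]

lemma hHat_εL_mul (x : A) :
    P.hHat (P.W.εL x * (Ring.inverse P.gR * Ring.inverse P.gR))
      = P.hHat (Ring.inverse P.gL * Ring.inverse P.gL * P.W.εR x) := by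
  rw [P.W.εL_eq, P.W.εR_eq]
  induction P.W.Δ x with
  | zero => simp
  | add u v hu hv => simp only [map_add, add_mul, mul_add, hu, hv]
  | tmul a b => simpa using P.hHat_mul_S_mul a b

lemma commute_jayEl (x : A) : Commute P.jayEl x := by
  have h₁ : (P.hHat ∘ₗ LinearMap.mulRight ℂ (Ring.inverse P.gR * Ring.inverse P.gR)) ∘ₗ P.W.εL
      = (P.hHat ∘ₗ LinearMap.mulLeft ℂ (Ring.inverse P.gL * Ring.inverse P.gL)) ∘ₗ P.W.εR := by
    ext y
    exact P.hHat_εL_mul y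
  have h₂ : (P.hHat ∘ₗ LinearMap.mulRight ℂ (Ring.inverse P.gR * Ring.inverse P.gR)) ∘ₗ
      P.W.S.toLinearMap
      = P.hHat ∘ₗ LinearMap.mulLeft ℂ (Ring.inverse P.gL * Ring.inverse P.gL) := by
    ext y
    have := P.hHat_S (Ring.inverse P.gL * Ring.inverse P.gL * y)
    rwa [P.W.S_antimul, P.W.S_antimul, S_inv_gL] at this
  rw [Commute, SemiconjBy, jayEl_eq, ← mul_lapp, ← P.W.map_εR_id, lapp_map_id, ← h₁,
    ← lapp_map_id (F := P.W.εL), P.W.map_εL_id, lapp_map_id, h₂, lapp_mul]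

lemma S_jayEl : P.W.S P.jayEl = P.jayEl := by
  obtain ⟨_, φ, -, hφ⟩ := P.haar_nondeg (Ring.inverse P.gL * Ring.inverse P.gL)
  have h : P.jayEl = rapp (φ ∘ₗ LinearMap.mulRight ℂ (P.W.S (P.gL * P.gL))) (P.W.Δ 1) := by
    rw [jayEl, ← hφ, P.W.lapp_Δ_rapp, ← P.gR_sq, gR_S, ← P.W.S_antimul,
      WeakHopfData.IsLeft.Δ_S _ (P.gL_isLeft.mul P.gL_isLeft)]
    induction P.W.Δ 1 with
    | zero => simp
    | add u v hu hv => simp only [map_add, add_mul, hu, hv]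
    | tmul a b => simp
  rw [← WeakHopfData.IsLeft.εR_eq_S _ P.jayEl_isLeft, h, P.W.εR_rapp_one]

lemma eq_sum_tmul_lapp {n : ℕ} {f : Fin n → A}
    (hf : ∀ x, ∑ i, P.hHat (star (f i) * x) • f i = x) (u : A ⊗[ℂ] A) :
    u = ∑ i, f i ⊗ₜ[ℂ] lapp (P.hHat ∘ₗ LinearMap.mulLeft ℂ (star (f i))) u := by
  induction u with
  | zero => simp
  | add u v hu hv =>
    nth_rewrite 1 [hu, hv]
    simp only [map_add, TensorProduct.tmul_add, Finset.sum_add_distrib]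
  | tmul a b =>
    conv_lhs => rw [← hf a]
    simp [TensorProduct.sum_tmul, TensorProduct.smul_tmul]

lemma jayEl_eq_sum {n : ℕ} {f : Fin n → A}
    (hf : ∀ x, ∑ i, P.hHat (star (f i) * x) • f i = x)
    (ho : ∀ i j, P.hHat (star (f i) * f j) = if i = j then 1 else 0) :
    P.jayEl = ∑ i, star (lapp (P.hHat ∘ₗ LinearMap.mulLeft ℂ (star (f i)))
      (P.W.Δ (Ring.inverse P.gL))) * lapp (P.hHat ∘ₗ LinearMap.mulLeft ℂ (star (f i)))
      (P.W.Δ (Ring.inverse P.gL)) := by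
  have hs : star (Ring.inverse P.gL) = Ring.inverse P.gL := by
    rw [← Ring.inverse_star, P.gL_pos.star_eq]
  have h := P.eq_sum_tmul_lapp hf (P.W.Δ (Ring.inverse P.gL))
  set b := fun i => lapp (P.hHat ∘ₗ LinearMap.mulLeft ℂ (star (f i)))
      (P.W.Δ (Ring.inverse P.gL))
  have h' : P.W.Δ (Ring.inverse P.gL) = ∑ i, star (f i) ⊗ₜ[ℂ] star (b i) := by
    rw [← hs, P.W.Δ_star, h]
    exact (map_sum P.W.starTHom _ _).trans (Finset.sum_congr rfl fun i _ => P.W.starT_tmul _ _)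
  rw [jayEl, P.W.Δ_mul]
  nth_rewrite 1 [h']
  rw [h]
  simp [Finset.sum_mul, Finset.mul_sum, ho, b]

lemma jayEl_pos : IsPosElem P.jayEl := by
  obtain ⟨n, f, hf, ho⟩ := P.exists_orthonormal
  rw [P.jayEl_eq_sum hf ho]
  exact isPosElem_sum_star_mul_self Finset.univ _

lemma jayEl_isUnit : IsUnit P.jayEl := by
  obtain ⟨n, f, hf, ho⟩ := P.exists_orthonormal
  refine isUnit_of_forall_commute P.commute_jayEl fun y hy => ?_
  rw [P.jayEl_eq_sum hf ho] at hy
  have h₁ : P.W.Δ (Ring.inverse P.gL) * ((1 : A) ⊗ₜ[ℂ] y) = 0 := by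
    rw [P.eq_sum_tmul_lapp hf (P.W.Δ (Ring.inverse P.gL)), Finset.sum_mul]
    refine Finset.sum_eq_zero fun i _ => ?_
    rw [Algebra.TensorProduct.tmul_mul_tmul,
      eq_zero_of_sum_star_mul_self_mul_eq_zero hy (Finset.mem_univ i), TensorProduct.tmul_zero]
  have h₂ := P.gL_isLeft.Δ_mul_left (Ring.inverse P.gL)
  rw [Ring.mul_inverse_cancel _ P.gL_unit] at h₂
  have h₃ : P.W.Δ 1 * ((1 : A) ⊗ₜ[ℂ] y) = 0 := by rw [h₂, mul_assoc, h₁, mul_zero]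
  have h₄ := lapp_mul P.W.ε (P.W.Δ 1) y
  rwa [h₃, P.W.lapp_ε, one_mul, map_zero, eq_comm] at h₄

end HaarPkg

namespace HaarPkg

variable {A : Type*} [NormedRing A] [StarRing A] [CStarRing A]
  [NormedAlgebra ℂ A] [StarModule ℂ A] [FiniteDimensional ℂ A] (P : HaarPkg A)

/-- The central element `ı^{1/2} ȷ^{1/2}`. -/
def sqrtIotaJay : A := P.sqrt P.iotaEl * P.sqrt P.jayEl

lemma commute_sqrt {a x : A} (ha : IsPosElem a) (h : Commute a x) : Commute (P.sqrt a) x :=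
  (P.sqrt_pos a ha).commute_of_mul_self (by rwa [P.sqrt_mul_self a ha])

lemma commute_sqrtIotaJay (x : A) : Commute P.sqrtIotaJay x :=
  (P.commute_sqrt P.iotaEl_pos (P.commute_iotaEl x)).mul_left
    (P.commute_sqrt P.jayEl_pos (P.commute_jayEl x))

lemma sqrtIotaJay_pos : IsPosElem P.sqrtIotaJay :=
  (P.sqrt_pos _ P.iotaEl_pos).mul (P.sqrt_pos _ P.jayEl_pos)
    (P.commute_sqrt P.iotaEl_pos (P.commute_iotaEl _))

lemma sqrtIotaJay_mul_self : P.sqrtIotaJay * P.sqrtIotaJay = P.iotaEl * P.jayEl := by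
  have h := P.commute_sqrt P.jayEl_pos (P.commute_jayEl (P.sqrt P.iotaEl))
  rw [sqrtIotaJay, h.mul_mul_mul_comm, P.sqrt_mul_self _ P.iotaEl_pos,
    P.sqrt_mul_self _ P.jayEl_pos]

lemma ξL_eq : P.ξL = P.sqrtIotaJay * P.gL := rfl

lemma ξR_eq : P.ξR = P.sqrtIotaJay * P.gR := rfl

lemma ξL_pos : IsPosElem P.ξL := P.sqrtIotaJay_pos.mul P.gL_pos (P.commute_sqrtIotaJay _)

lemma ξR_pos : IsPosElem P.ξR := P.sqrtIotaJay_pos.mul P.gR_pos (P.commute_sqrtIotaJay _)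

lemma commute_ξL {x : A} (h : Commute P.gL x) : Commute P.ξL x :=
  (P.commute_sqrtIotaJay x).mul_left h

lemma commute_ξR {x : A} (h : Commute P.gR x) : Commute P.ξR x :=
  (P.commute_sqrtIotaJay x).mul_left h

lemma ξ_pos : IsPosElem P.ξ :=
  P.ξL_pos.mul P.ξR_pos (P.commute_ξL (P.commute_ξR P.commute_gL_gR.symm).symm)

lemma commute_ξ_g : Commute P.ξ P.g := by
  have hL : Commute P.gL P.g := (Commute.refl _).mul_right P.commute_gL_inv_gR
  have hR : Commute P.gR P.g :=
    P.commute_gL_gR.symm.mul_right (commute_ringInverse_right (Commute.refl _))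
  exact (P.commute_ξL hL).mul_left (P.commute_ξR hR)

lemma ξ_eq : P.ξ = P.iotaEl * P.jayEl * (P.gL * P.gR) := by
  rw [ξ, ξL_eq, ξR_eq, (P.commute_sqrtIotaJay P.gL).symm.mul_mul_mul_comm, sqrtIotaJay_mul_self]

lemma commute_sqrt_ξ_sqrt_g : Commute (P.sqrt P.ξ) (P.sqrt P.g) :=
  P.commute_sqrt P.ξ_pos (P.commute_sqrt P.g_pos P.commute_ξ_g.symm).symm

lemma ξR_mul_g : P.ξR * P.g = P.ξL := by
  rw [ξR_eq, ξL_eq, g, P.commute_gL_inv_gR.eq, mul_assoc,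
    Ring.mul_inverse_cancel_left _ _ P.gR_unit]

lemma sqrt_g_mul_self : P.sqrt P.g * P.sqrt P.g = P.g := P.sqrt_mul_self _ P.g_pos

lemma sqrt_g_mul_sqrt_ξ : P.sqrt P.g * P.sqrt P.ξ = P.ξL := by
  refine IsPosElem.eq_of_mul_self_eq ((P.sqrt_pos _ P.g_pos).mul (P.sqrt_pos _ P.ξ_pos)
    P.commute_sqrt_ξ_sqrt_g.symm) P.ξL_pos ?_
  calc P.sqrt P.g * P.sqrt P.ξ * (P.sqrt P.g * P.sqrt P.ξ) = P.ξ * P.g := by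
        rw [P.commute_sqrt_ξ_sqrt_g.mul_mul_mul_comm, sqrt_g_mul_self,
          P.sqrt_mul_self _ P.ξ_pos, P.commute_ξ_g.eq]
    _ = P.ξL * P.ξL := by rw [ξ, mul_assoc, ξR_mul_g]

lemma sqrt_g_isUnit : IsUnit (P.sqrt P.g) := by
  have h : IsUnit (P.sqrt P.g * P.sqrt P.g) := P.sqrt_g_mul_self.symm ▸ P.g_unit
  exact ((Commute.refl _).isUnit_mul_iff.1 h).1

lemma sqrt_ξ_mul_inverse_sqrt_g : P.sqrt P.ξ * Ring.inverse (P.sqrt P.g) = P.ξR := by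
  refine P.sqrt_g_isUnit.mul_right_cancel (P.sqrt_g_isUnit.mul_right_cancel ?_)
  rw [Ring.inverse_mul_cancel_right _ _ P.sqrt_g_isUnit, mul_assoc P.ξR,
    sqrt_g_mul_self, ξR_mul_g, P.commute_sqrt_ξ_sqrt_g.eq, sqrt_g_mul_sqrt_ξ]

/-- `⟨ĥ, a S(h₍₁₎) S²(b)⟩ h₍₂₎ = b gR² a`. -/
lemma lapp_hHat_S (a b : A) :
    lapp (P.hHat ∘ₗ LinearMap.mulRight ℂ (P.W.S (P.W.S b)) ∘ₗ LinearMap.mulLeft ℂ a ∘ₗ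
      P.W.S.toLinearMap) (P.W.Δ P.h) = b * (P.gR * P.gR) * a := by
  obtain ⟨a, rfl⟩ := P.W.S.surjective a
  rw [← lapp_hHat]
  congr 2
  ext y
  simp [← P.W.S_antimul, P.hHat_S, mul_assoc]

lemma Δ_Ω : P.W.Δ P.Ω = ((Ring.inverse P.iotaEl * Ring.inverse P.gL) ⊗ₜ[ℂ] (1 : A)) * P.W.Δ P.h *
    (Ring.inverse P.gL ⊗ₜ[ℂ] (1 : A)) := by
  rw [Ω, P.inv_gL_isLeft.Δ_mul_right,
    ((P.iotaEl_isLeft.ringInverse P.iotaEl_isUnit).mul P.inv_gL_isLeft).Δ_mul_left]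

lemma commute_inverse_iotaEl (x : A) : Commute (Ring.inverse P.iotaEl) x :=
  (commute_ringInverse_right (P.commute_iotaEl x).symm).symm

lemma commute_inverse_jayEl (x : A) : Commute (Ring.inverse P.jayEl) x :=
  (commute_ringInverse_right (P.commute_jayEl x).symm).symm

lemma S_inverse_iotaEl : P.W.S (Ring.inverse P.iotaEl) = Ring.inverse P.iotaEl := by
  rw [P.S_inverse P.iotaEl_isUnit, S_iotaEl]

lemma S_inverse_jayEl : P.W.S (Ring.inverse P.jayEl) = Ring.inverse P.jayEl := by
  rw [P.S_inverse P.jayEl_isUnit, S_jayEl]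

lemma lapp_ω_Ω : lapp P.ω (P.W.Δ P.Ω) = Ring.inverse P.ξ := by
  have h₁ : Ring.inverse P.jayEl * (Ring.inverse P.gL * Ring.inverse P.gR) *
      (Ring.inverse P.iotaEl * Ring.inverse P.gL)
      = P.W.S (Ring.inverse P.gR * Ring.inverse P.iotaEl *
        (Ring.inverse P.gL * Ring.inverse P.gR) * Ring.inverse P.jayEl) := by
    simp only [P.W.S_antimul, S_inv_gR, S_inv_gL, S_inverse_iotaEl, S_inverse_jayEl, mul_assoc]
  have h₂ : P.ω ∘ₗ LinearMap.mulRight ℂ (Ring.inverse P.gL) ∘ₗ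
      LinearMap.mulLeft ℂ (Ring.inverse P.iotaEl * Ring.inverse P.gL)
      = P.hHat ∘ₗ LinearMap.mulRight ℂ (Ring.inverse P.gL) ∘ₗ
        LinearMap.mulLeft ℂ (P.W.S (Ring.inverse P.gR * Ring.inverse P.iotaEl *
        (Ring.inverse P.gL * Ring.inverse P.gR) * Ring.inverse P.jayEl)) := by
    rw [← h₁]
    ext y
    simp [ω, mul_assoc]
  rw [Δ_Ω, lapp_tmul_one_mul_mul, h₂, lapp_hHat, S_inv_gL, ξ_eq,
    Ring.mul_inverse_rev' ((P.commute_iotaEl _).mul_left (P.commute_jayEl _)),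
    Ring.mul_inverse_rev' (P.commute_iotaEl _), Ring.mul_inverse_rev' P.commute_gL_gR,
    ← (P.commute_inverse_iotaEl _).eq]
  simp only [mul_assoc]
  rw [(P.commute_inverse_iotaEl _).eq, (P.commute_inverse_jayEl _).eq]
  simp only [mul_assoc, Ring.inverse_mul_cancel_left _ _ P.gR_unit,
    Ring.mul_inverse_cancel_left _ _ P.gR_unit]

lemma lapp_ω_ξ_J_Ω (x : A) :
    lapp (P.ω ∘ₗ LinearMap.mulRight ℂ x ∘ₗ LinearMap.mulRight ℂ (P.sqrt P.ξ) ∘ₗ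
      LinearMap.mulLeft ℂ (P.sqrt P.ξ) ∘ₗ P.Jlin) (P.W.Δ P.Ω) = x := by
  let b := Ring.inverse P.iotaEl * P.sqrtIotaJay * (x * P.g)
  let a := Ring.inverse P.jayEl * P.sqrtIotaJay * (Ring.inverse P.gL * Ring.inverse P.gR)
  have ha : Ring.inverse P.jayEl * (Ring.inverse P.gL * Ring.inverse P.gR) * P.ξR *
      Ring.inverse P.gR = a := by
    simp only [a, ξR_eq, mul_assoc, Ring.mul_inverse_cancel _ P.gR_unit, mul_one]
    rw [← mul_assoc (Ring.inverse P.gL), ← (P.commute_sqrtIotaJay _).eq]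
  have hb : Ring.inverse P.gR * Ring.inverse P.iotaEl * P.ξL * x = P.W.S (P.W.S b) := by
    have h := P.S_sq b
    change P.W.S (P.W.S b) = P.g * b * Ring.inverse P.g at h
    rw [h, mul_assoc]
    simp only [b, mul_assoc, Ring.mul_inverse_cancel _ (show IsUnit P.g from P.g_unit), mul_one,
      ξL_eq]
    rw [← (P.commute_inverse_iotaEl _).left_comm, ← (P.commute_sqrtIotaJay _).left_comm,
      ← (P.commute_inverse_iotaEl P.g).left_comm, ← (P.commute_sqrtIotaJay P.g).left_comm,
      ← mul_assoc (Ring.inverse P.gR), ← P.commute_gL_inv_gR.eq, g]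
  have hab : b * (P.gR * P.gR) * a = x := by
    have h₁ : P.g * (P.gR * P.gR) * (Ring.inverse P.gL * Ring.inverse P.gR) = 1 := by
      simp only [g, mul_assoc, Ring.inverse_mul_cancel_left _ _ P.gR_unit]
      rw [P.commute_gR_inv_gL.left_comm, Ring.mul_inverse_cancel _ P.gR_unit, mul_one,
        Ring.mul_inverse_cancel _ P.gL_unit]
    have h₂ : Ring.inverse P.iotaEl * P.sqrtIotaJay * (Ring.inverse P.jayEl * P.sqrtIotaJay)
        = 1 := by
      rw [← (P.commute_inverse_jayEl _).mul_mul_mul_comm, sqrtIotaJay_mul_self,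
        mul_assoc, (P.commute_inverse_jayEl _).left_comm,
        Ring.inverse_mul_cancel_left _ _ P.iotaEl_isUnit,
        Ring.inverse_mul_cancel _ P.jayEl_isUnit]
    have h₃ := (P.commute_inverse_jayEl (x * P.g * (P.gR * P.gR))).mul_left
      (P.commute_sqrtIotaJay (x * P.g * (P.gR * P.gR)))
    calc b * (P.gR * P.gR) * a
        = Ring.inverse P.iotaEl * P.sqrtIotaJay * ((x * P.g * (P.gR * P.gR)) *
          (Ring.inverse P.jayEl * P.sqrtIotaJay)) * (Ring.inverse P.gL * Ring.inverse P.gR) := by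
          simp only [a, b, mul_assoc]
      _ = Ring.inverse P.iotaEl * P.sqrtIotaJay * (Ring.inverse P.jayEl * P.sqrtIotaJay) *
          (x * (P.g * (P.gR * P.gR) * (Ring.inverse P.gL * Ring.inverse P.gR))) := by
          rw [← h₃.eq]
          simp only [mul_assoc]
      _ = x := by rw [h₁, h₂, one_mul, mul_one]
  rw [Δ_Ω, lapp_tmul_one_mul_mul]
  refine Eq.trans ?_ ((P.lapp_hHat_S a b).trans hab)
  congr 2
  ext y
  have h₁ := P.sqrt_ξ_mul_inverse_sqrt_g
  have h₂ := P.sqrt_g_mul_sqrt_ξ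
  rw [← ha, ← hb, ← h₁, ← h₂]
  simp [ω, Jlin, P.W.S_antimul, S_inv_gL, S_inverse_iotaEl, mul_assoc]

end HaarPkg

/-- `⟨ω, ξ^{1/2} J(Ω₍₁₎) ξ^{1/2} x⟩ Ω₍₂₎ = x` for all `x ∈ A`; equivalently,
`⟨ω, Ω₍₁₎⟩ Ω₍₂₎ = ξ⁻¹`. -/
theorem HaarPkg.omega_xi_duality {A : Type*} [NormedRing A] [StarRing A] [CStarRing A]
    [NormedAlgebra ℂ A] [StarModule ℂ A] [FiniteDimensional ℂ A]
    (P : HaarPkg A) :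
    (∀ x : A,
      lapp (P.ω ∘ₗ LinearMap.mulRight ℂ x ∘ₗ LinearMap.mulRight ℂ (P.sqrt P.ξ) ∘ₗ
          LinearMap.mulLeft ℂ (P.sqrt P.ξ) ∘ₗ P.Jlin) (P.W.Δ P.Ω) = x) ∧
    lapp P.ω (P.W.Δ P.Ω) = Ring.inverse P.ξ :=
  ⟨P.lapp_ω_ξ_J_Ω, P.lapp_ω_Ω⟩

end
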